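/- Let w be a C² function of (x,t) on an open subset of (ℝ³ \ {0}) × ℝ. Then at every point of its domain, with summation over 1 ≤ i < j ≤ 3 and writing r = |x|, w_t = ∂_t w, w_r = ∂_r w, w_{tt} = ∂_t∂_t w, w_{rr} = ∂_r∂_r w: 2 w_r ( w_{tt} − w_{rr} − r^{-2} Ω w − w ) − 4 r^{-2} Σ (Ω_{ij} w_r)(Ω_{ij} w) + 2 r^{-3} Σ (Ω_{ij} w)² = − ∂_r ( w_t² + w_r² + r^{-2} Σ (Ω_{ij} w)² + w² ) + 2 ∂_t ( w_r w_t ) − 2 Σ Ω_{ij} ( r^{-2} w_r Ω_{ij} w ), where all derivatives ∂_r and Ω_{ij} act in the spatial variable x with t fixed. -/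

import Mathlib

noncomputable section

open Real MeasureTheory Metric Set

/-- Euclidean 3-space. -/
abbrev E3 : Type := EuclideanSpace ℝ (Fin 3)

/-- The `i`-th standard basis vector of `ℝ³`. -/
def basis3 (i : Fin 3) : E3 := EuclideanSpace.single i 1

/-- The partial derivative `∂ᵢ f` of a function on `ℝ³`. -/
def pd (i : Fin 3) (f : E3 → ℝ) (x : E3) : ℝ := fderiv ℝ f x (basis3 i)

/-- The Laplacian `Δf` on `ℝ³`. -/
def lap (f : E3 → ℝ) (x : E3) : ℝ := ∑ i, pd i (pd i f) x

/-- The radial derivative `∂_r f(x) = (x/|x|)·∇f(x)`. -/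
def pdr (f : E3 → ℝ) (x : E3) : ℝ := ‖x‖⁻¹ * ∑ i, x i * pd i f x

/-- The angular derivative `Ω_{ij} f = xᵢ ∂ⱼ f − xⱼ ∂ᵢ f`. -/
def ang (i j : Fin 3) (f : E3 → ℝ) (x : E3) : ℝ := x i * pd j f x - x j * pd i f x

/-- `Ω f = Σ_{i<j} Ω_{ij}(Ω_{ij} f)`. -/
def angLap (f : E3 → ℝ) (x : E3) : ℝ :=
  ∑ i, ∑ j, if i < j then ang i j (ang i j f) x else 0

/-- The squared length `|∇f(x)|²` of the gradient. -/
def gradsq (f : E3 → ℝ) (x : E3) : ℝ := ∑ i, (pd i f x) ^ 2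

/-- `Σ_{i<j} (Ω_{ij} g)²`. -/
def angsq (g : E3 → ℝ) (x : E3) : ℝ := ∑ i, ∑ j, if i < j then (ang i j g x) ^ 2 else 0

/-- `Σ_{i<j} Σ_{k<l} (Ω_{kl} Ω_{ij} g)²`. -/
def angsq2 (g : E3 → ℝ) (x : E3) : ℝ :=
  ∑ i, ∑ j, ∑ k, ∑ l, if i < j ∧ k < l then (ang k l (ang i j g) x) ^ 2 else 0

/-- The time derivative `∂_t u` of a space-time function. -/
def pdt (u : E3 × ℝ → ℝ) (p : E3 × ℝ) : ℝ := fderiv ℝ u p (0, 1)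

/-- The spatial slice `x ↦ u(x,t)` of a space-time function, at fixed time `t`. -/
def fixT (u : E3 × ℝ → ℝ) (t : ℝ) : E3 → ℝ := fun y => u (y, t)

/-- The spatial partial derivative `∂ᵢ u` of a space-time function (`t` fixed). -/
def pdx (i : Fin 3) (u : E3 × ℝ → ℝ) (p : E3 × ℝ) : ℝ := pd i (fixT u p.2) p.1

/-- The spatial radial derivative `∂_r u` of a space-time function (`t` fixed). -/
def pdrX (u : E3 × ℝ → ℝ) (p : E3 × ℝ) : ℝ := pdr (fixT u p.2) p.1

/-- The spatial angular derivative `Ω_{ij} u` of a space-time function (`t` fixed). -/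
def angX (i j : Fin 3) (u : E3 × ℝ → ℝ) (p : E3 × ℝ) : ℝ := ang i j (fixT u p.2) p.1

/-- The spatial operator `Ω u` of a space-time function (`t` fixed). -/
def angLapX (u : E3 × ℝ → ℝ) (p : E3 × ℝ) : ℝ := angLap (fixT u p.2) p.1

/-- The spatial Laplacian `Δu` of a space-time function (`t` fixed). -/
def lapX (u : E3 × ℝ → ℝ) (p : E3 × ℝ) : ℝ := lap (fixT u p.2) p.1

/-- The squared spatial gradient `|∇u|²` of a space-time function (`t` fixed). -/
def gradsqX (u : E3 × ℝ → ℝ) (p : E3 × ℝ) : ℝ := gradsq (fixT u p.2) p.1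

/-- `Σ_{i<j} (Ω_{ij} w)²` for a space-time function (`t` fixed). -/
def angsqX (w : E3 × ℝ → ℝ) (p : E3 × ℝ) : ℝ :=
  ∑ i, ∑ j, if i < j then (angX i j w p) ^ 2 else 0

/-- The solid light cone `t ≥ |x|`. -/
def cone : Set (E3 × ℝ) := {p | ‖p.1‖ ≤ p.2}

/-- `u` is a C² solution of the Goursat problem for `q` on the cone `t ≥ |x|`:
`∂_t²u − Δu − q u = 0` for `t > |x|` and `u(x,|x|) = ∫₀¹ q(σx) dσ`. -/
def GoursatSol (q : E3 → ℝ) (u : E3 × ℝ → ℝ) : Prop :=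
  ContDiffOn ℝ 2 u cone ∧
  (∀ p : E3 × ℝ, ‖p.1‖ < p.2 → pdt (pdt u) p - lapX u p - q p.1 * u p = 0) ∧
  (∀ x : E3, u (x, ‖x‖) = ∫ σ in (0:ℝ)..1, q (σ • x))

/-- `p(x) = ∫₀^{|x|} q(σ x/|x|) dσ`. -/
def pfun (q : E3 → ℝ) (x : E3) : ℝ := ∫ σ in (0:ℝ)..‖x‖, q ((σ / ‖x‖) • x)

/-- Integral over the sphere of radius `r` with respect to surface measure. -/
def sphInt (r : ℝ) (g : E3 → ℝ) : ℝ := ∫ x in sphere (0:E3) r, g x ∂μH[2]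

/-- Squared `L²` norm on the sphere of radius `r`. -/
def L2sq (g : E3 → ℝ) (r : ℝ) : ℝ := sphInt r (fun x => (g x) ^ 2)

/-- Squared `H¹` norm on the sphere of radius `r`. -/
def H1sq (g : E3 → ℝ) (r : ℝ) : ℝ := sphInt r (fun x => (g x) ^ 2 + (r ^ 2)⁻¹ * angsq g x)

/-- Squared `H²` norm on the sphere of radius `r`. -/
def H2sq (g : E3 → ℝ) (r : ℝ) : ℝ := H1sq g r + sphInt r (fun x => (r ^ 4)⁻¹ * angsq2 g x)

/-- The class `Q_γ(R,T)`. -/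
def memQ (R T γ : ℝ) (q : E3 → ℝ) : Prop :=
  ∀ r ∈ Icc R ((R + T) / 2),
    Real.sqrt (H2sq (pfun q) r) + Real.sqrt (H1sq (pdr (pfun q)) r) ≤
      γ * (Real.sqrt (H1sq (pfun q) r) + Real.sqrt (L2sq (pdr (pfun q)) r))

/-- The closed annulus `R ≤ |x| ≤ ρ` in `ℝ³`. -/
def Ann (R ρ : ℝ) : Set E3 := {x | R ≤ ‖x‖ ∧ ‖x‖ ≤ ρ}

/-- The space-time region `K_ρ = {R ≤ |x| ≤ ρ, |x| ≤ t ≤ R+T−|x|}`. -/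
def Kreg (R T ρ : ℝ) : Set (E3 × ℝ) :=
  {p | R ≤ ‖p.1‖ ∧ ‖p.1‖ ≤ ρ ∧ ‖p.1‖ ≤ p.2 ∧ p.2 ≤ R + T - ‖p.1‖}

/-- `F = ∂_t²w − ∂_r∂_r w − |x|^{-2} Ω w`. -/
def Fop (w : E3 × ℝ → ℝ) (p : E3 × ℝ) : ℝ :=
  pdt (pdt w) p - pdrX (pdrX w) p - (‖p.1‖ ^ 2)⁻¹ * angLapX w p

/-- The sideways energy `J(ρ)`. -/
def Jfun (R T : ℝ) (w : E3 × ℝ → ℝ) (ρ : ℝ) : ℝ :=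
  ∫ t in ρ..(R + T - ρ), sphInt ρ
    (fun x => (ρ ^ 2)⁻¹ * ((w (x, t)) ^ 2 + (pdt w (x, t)) ^ 2 + gradsqX w (x, t)))

/-- The unit radial vector field on space-time. -/
def radialField (p : E3 × ℝ) : E3 × ℝ := (‖p.1‖⁻¹ • p.1, 0)

/-- The infinitesimal rotation `x ↦ xᵢ eⱼ − xⱼ eᵢ`, as a linear map on space-time. -/
def rotField (i j : Fin 3) : E3 × ℝ →L[ℝ] E3 × ℝ :=
  (ContinuousLinearMap.inl ℝ E3 ℝ).comp
    ((((EuclideanSpace.proj i : E3 →L[ℝ] ℝ).smulRight (basis3 j)) -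
      ((EuclideanSpace.proj j : E3 →L[ℝ] ℝ).smulRight (basis3 i))).comp
        (ContinuousLinearMap.fst ℝ E3 ℝ))

lemma rotField_apply (i j : Fin 3) (p : E3 × ℝ) :
    rotField i j p = (p.1 i • basis3 j - p.1 j • basis3 i, 0) := by
  simp [rotField]

lemma sum_smul_basis3 (x : E3) : ∑ i, x i • basis3 i = x := by
  ext k
  fin_cases k <;> simp [Fin.sum_univ_three, basis3]

lemma inner_rotField (i j : Fin 3) (p : E3 × ℝ) : inner ℝ p.1 (rotField i j p).1 = 0 := by
  simp only [rotField_apply, basis3, inner_sub_right, inner_smul_right,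
    EuclideanSpace.inner_single_right]
  simp [mul_comm]

lemma pd_fixT {f : E3 × ℝ → ℝ} {p : E3 × ℝ} (hf : DifferentiableAt ℝ f p) (i : Fin 3) :
    pd i (fixT f p.2) p.1 = fderiv ℝ f p (basis3 i, 0) := by
  have h : HasFDerivAt (fixT f p.2)
      ((fderiv ℝ f p).comp (ContinuousLinearMap.inl ℝ E3 ℝ)) p.1 :=
    HasFDerivAt.comp (g := f) p.1 hf.hasFDerivAt (hasFDerivAt_prodMk_left p.1 p.2)
  simp [pd, h.fderiv]

lemma pdrX_eq_fderiv {f : E3 × ℝ → ℝ} {p : E3 × ℝ} (hf : DifferentiableAt ℝ f p) :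
    pdrX f p = fderiv ℝ f p (radialField p) := by
  have h : radialField p = ‖p.1‖⁻¹ • ∑ i, p.1 i • (basis3 i, (0 : ℝ)) := by
    refine Prod.ext ?_ ?_
    · simp only [radialField, Prod.smul_fst, Prod.fst_sum]
      rw [sum_smul_basis3]
    · simp [radialField, Prod.snd_sum]
  simp only [h, pdrX, pdr, pd_fixT hf, map_smul, map_sum, smul_eq_mul]

lemma angX_eq_fderiv {f : E3 × ℝ → ℝ} {p : E3 × ℝ} (hf : DifferentiableAt ℝ f p)
    (i j : Fin 3) : angX i j f p = fderiv ℝ f p (rotField i j p) := by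
  have h : rotField i j p = p.1 i • (basis3 j, (0 : ℝ)) - p.1 j • (basis3 i, (0 : ℝ)) := by
    simp [rotField_apply]
  simp only [h, angX, ang, pd_fixT hf, map_sub, map_smul, smul_eq_mul]

lemma hasFDerivAt_norm_fst {p : E3 × ℝ} (hp : p.1 ≠ 0) :
    HasFDerivAt (fun z : E3 × ℝ => ‖z.1‖)
      (‖p.1‖⁻¹ • (innerSL ℝ p.1).comp (ContinuousLinearMap.fst ℝ E3 ℝ)) p := by
  have h0 : ‖p.1‖ ^ 2 ≠ 0 := by simpa using hp
  have h := ((hasFDerivAt_fst (𝕜 := ℝ) (p := p)).norm_sq).sqrt h0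
  simp only [Real.sqrt_sq (norm_nonneg _)] at h
  refine h.congr_fderiv ?_
  rw [← Nat.cast_smul_eq_nsmul ℝ 2, smul_smul]
  congr 1
  push_cast
  field_simp

lemma hasFDerivAt_radialField {p : E3 × ℝ} (hp : p.1 ≠ 0) :
    ∃ L : E3 × ℝ →L[ℝ] E3 × ℝ, HasFDerivAt radialField L p ∧
      ∀ v, inner ℝ p.1 v.1 = 0 → L v = (‖p.1‖⁻¹ • v.1, 0) := by
  have h0 : ‖p.1‖ ≠ 0 := by simpa using hp
  have h := (((hasDerivAt_inv h0).comp_hasFDerivAt p (hasFDerivAt_norm_fst hp)).smul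
    (hasFDerivAt_fst (𝕜 := ℝ) (p := p))).prodMk (hasFDerivAt_const (0 : ℝ) p)
  refine ⟨_, h, fun v hv => ?_⟩
  simp [hv]

lemma hasFDerivAt_inv_norm_sq_fst {p : E3 × ℝ} (hp : p.1 ≠ 0) :
    ∃ L : E3 × ℝ →L[ℝ] ℝ, HasFDerivAt (fun z : E3 × ℝ => (‖z.1‖ ^ 2)⁻¹) L p ∧
      L (radialField p) = -2 * (‖p.1‖ ^ 3)⁻¹ ∧ ∀ v, inner ℝ p.1 v.1 = 0 → L v = 0 := by
  have h0 : ‖p.1‖ ^ 2 ≠ 0 := by simpa using hp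
  have h1 : ‖p.1‖ ≠ 0 := by simpa using hp
  have h := (hasDerivAt_inv h0).comp_hasFDerivAt p
    ((hasFDerivAt_fst (𝕜 := ℝ) (p := p)).norm_sq)
  refine ⟨_, h, ?_, fun v hv => ?_⟩
  · simp [radialField]
    field_simp
  · simp [hv]

section DirectionalDerivative

variable {E : Type*} [NormedAddCommGroup E] [NormedSpace ℝ E]

lemma hasFDerivAt_fderiv_apply {w : E → ℝ} {p : E} (hw : ContDiffAt ℝ 2 w p)
    {V : E → E} {L : E →L[ℝ] E} (hV : HasFDerivAt V L p) :
    HasFDerivAt (fun z => fderiv ℝ w z (V z))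
      ((fderiv ℝ w p).comp L + (fderiv ℝ (fderiv ℝ w) p).flip (V p)) p :=
  ((hw.fderiv_right (m := 1) (by norm_num)).differentiableAt
    (by norm_num)).hasFDerivAt.clm_apply hV

/-- Directional derivatives along commuting vector fields commute. -/
lemma fderiv_fderiv_apply_comm {w : E → ℝ} {p : E} (hw : ContDiffAt ℝ 2 w p)
    {U V : E → E} {K L : E →L[ℝ] E} (hU : HasFDerivAt U K p) (hV : HasFDerivAt V L p)
    (h : L (U p) = K (V p)) :
    fderiv ℝ (fun z => fderiv ℝ w z (V z)) p (U p) =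
      fderiv ℝ (fun z => fderiv ℝ w z (U z)) p (V p) := by
  rw [(hasFDerivAt_fderiv_apply hw hU).fderiv, (hasFDerivAt_fderiv_apply hw hV).fderiv]
  have hs := hw.isSymmSndFDerivAt (by simp) (U p) (V p)
  simp [h, hs]

end DirectionalDerivative

/-- **identity (2.5).** The pointwise sideways-energy identity. -/
theorem stmt11 (S : Set (E3 × ℝ)) (hS : IsOpen S) (hS0 : ∀ p ∈ S, p.1 ≠ 0)
    (w : E3 × ℝ → ℝ) (hw : ContDiffOn ℝ 2 w S) (p : E3 × ℝ) (hp : p ∈ S) :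
    2 * pdrX w p *
        (pdt (pdt w) p - pdrX (pdrX w) p - (‖p.1‖ ^ 2)⁻¹ * angLapX w p - w p)
      - 4 * (‖p.1‖ ^ 2)⁻¹ *
          (∑ i, ∑ j, if i < j then angX i j (pdrX w) p * angX i j w p else 0)
      + 2 * (‖p.1‖ ^ 3)⁻¹ * angsqX w p
    = - pdrX (fun z => (pdt w z) ^ 2 + (pdrX w z) ^ 2
          + (‖z.1‖ ^ 2)⁻¹ * angsqX w z + (w z) ^ 2) p
      + 2 * pdt (fun z => pdrX w z * pdt w z) p
      - 2 * (∑ i, ∑ j, if i < j then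
          angX i j (fun z => (‖z.1‖ ^ 2)⁻¹ * pdrX w z * angX i j w z) p else 0) := by
  have hx : p.1 ≠ 0 := hS0 p hp
  have hpS : ∀ᶠ z in nhds p, DifferentiableAt ℝ w z := by
    filter_upwards [hS.mem_nhds hp] with z hz
    exact (hw.contDiffAt (hS.mem_nhds hz)).differentiableAt (by norm_num)
  have hwp : ContDiffAt ℝ 2 w p := hw.contDiffAt (hS.mem_nhds hp)
  obtain ⟨K, hK, hKv⟩ := hasFDerivAt_radialField hx
  obtain ⟨dρ, hρ, hρr, hρv⟩ := hasFDerivAt_inv_norm_sq_fst hx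
  have er : pdrX w =ᶠ[nhds p] fun z => fderiv ℝ w z (radialField z) :=
    hpS.mono fun z hz => pdrX_eq_fderiv hz
  have ea (i j) : angX i j w =ᶠ[nhds p] fun z => fderiv ℝ w z (rotField i j z) :=
    hpS.mono fun z hz => angX_eq_fderiv hz i j
  have hT : HasFDerivAt (fun _ : E3 × ℝ => ((0 : E3), (1 : ℝ)))
      (0 : E3 × ℝ →L[ℝ] E3 × ℝ) p := hasFDerivAt_const _ _
  have hR (i j) : HasFDerivAt (rotField i j) (rotField i j) p := (rotField i j).hasFDerivAt
  have dw : DifferentiableAt ℝ w p := hpS.self_of_nhds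
  have dt : DifferentiableAt ℝ (pdt w) p := (hasFDerivAt_fderiv_apply hwp hT).differentiableAt
  have dr : DifferentiableAt ℝ (pdrX w) p :=
    ((hasFDerivAt_fderiv_apply hwp hK).congr_of_eventuallyEq er).differentiableAt
  have da (i j) : DifferentiableAt ℝ (angX i j w) p :=
    ((hasFDerivAt_fderiv_apply hwp (hR i j)).congr_of_eventuallyEq (ea i j)).differentiableAt
  have ctr : fderiv ℝ (pdt w) p (radialField p) = fderiv ℝ (pdrX w) p (0, 1) := by
    rw [er.fderiv_eq]
    refine fderiv_fderiv_apply_comm hwp hK hT ?_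
    rw [hKv _ (by simp)]
    simp only [zero_apply, smul_zero]
    rfl
  have car (i j) : fderiv ℝ (angX i j w) p (radialField p) =
      fderiv ℝ (pdrX w) p (rotField i j p) := by
    rw [er.fderiv_eq, (ea i j).fderiv_eq]
    refine fderiv_fderiv_apply_comm hwp hK (hR i j) ?_
    rw [hKv _ (inner_rotField i j p)]
    have h : radialField p = ‖p.1‖⁻¹ • (p.1, (0 : ℝ)) := by simp [radialField]
    rw [h, map_smul]
    simp [rotField_apply]
  have energy := (((dt.hasFDerivAt.pow 2).add (dr.hasFDerivAt.pow 2)).add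
    (hρ.mul ((((da 0 1).hasFDerivAt.pow 2).add ((da 0 2).hasFDerivAt.pow 2)).add
      ((da 1 2).hasFDerivAt.pow 2)))).add (dw.hasFDerivAt.pow 2)
  have energy_eq : pdrX (fun z => (pdt w z) ^ 2 + (pdrX w z) ^ 2
      + (‖z.1‖ ^ 2)⁻¹ * angsqX w z + (w z) ^ 2) p = _ :=
    (congrArg (pdrX · p) (by
      funext z
      simp [angsqX, Fin.sum_univ_three])).trans
      ((pdrX_eq_fderiv energy.differentiableAt).trans
        (congrArg (fun L : E3 × ℝ →L[ℝ] ℝ => L (radialField p)) energy.fderiv))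
  have flux_t : pdt (fun z => pdrX w z * pdt w z) p =
      pdrX w p * pdt (pdt w) p + pdt w p * fderiv ℝ (pdrX w) p (0, 1) := by
    have h := dr.hasFDerivAt.mul dt.hasFDerivAt
    exact (congrArg (fun L : E3 × ℝ →L[ℝ] ℝ => L (0, 1)) h.fderiv).trans (by simp [pdt])
  have flux_a (i j) : angX i j (fun z => (‖z.1‖ ^ 2)⁻¹ * pdrX w z * angX i j w z) p =
      (‖p.1‖ ^ 2)⁻¹ * (pdrX w p * angX i j (angX i j w) p
        + angX i j (pdrX w) p * angX i j w p) := by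
    have h := (hρ.mul dr.hasFDerivAt).mul (da i j).hasFDerivAt
    refine (angX_eq_fderiv h.differentiableAt i j).trans
      ((congrArg (fun L : E3 × ℝ →L[ℝ] ℝ => L (rotField i j p)) h.fderiv).trans ?_)
    rw [angX_eq_fderiv (da i j), angX_eq_fderiv dr]
    simp [hρv _ (inner_rotField i j p)]
    ring
  have lap_eq : angLapX w p = ∑ i, ∑ j, if i < j then angX i j (angX i j w) p else 0 := rfl
  rw [energy_eq, flux_t, lap_eq, pdrX_eq_fderiv dr]
  simp only [flux_a, angX_eq_fderiv dr, angsqX, Fin.sum_univ_three]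
  simp [ctr, car, hρr, ← pdrX_eq_fderiv dw]
  ring
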